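/- arXiv:2109.05079 — 2 statements merged into one kernel-verified Lean document; each statement's English description precedes it below -/
import Mathlib

section
/- Let q be a conservative Q-function satisfying Assumption L1. Then P̄ is a transition function, that is: (i) for each u ∈ [T₀,T₁), t ∈ (u,T₁), x ∈ X, the set function P̄(u,x;t,·) is a measure on (X,𝓑(X)) with values in [0,1]; (ii) for each B ∈ 𝓑(X), the map (u,x,t) ↦ P̄(u,x;t,B) is Borel measurable; (iii) the Chapman–Kolmogorov equation holds: P̄(u,x;t,B) = ∫_X P̄(s,y;t,B) P̄(u,x;s,dy) for all T₀ ≤ u < s < t < T₁, x ∈ X, B ∈ 𝓑(X). -/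
open MeasureTheory Set Filter Topology
open scoped ENNReal

noncomputable section

/-- A conservative `Q`-function on the state space `X` with time horizon `[T₀, T₁)`,
`T₁ ≤ +∞`.  It is encoded by the kernel `qp x t = q(x, t, · \ {x})`; since `q` is
conservative, the signed measure `q(x,t,·)` is recovered as
`q(x,t,B) = qp x t B - qp x t univ · 1{x ∈ B}`, so that `q(x,t,X) = 0`. -/
structure ConsQFun (X : Type*) [MeasurableSpace X] (T₀ : ℝ) (T₁ : EReal) where
  qp : X → ℝ → Measure X
  fin : ∀ x t, qp x t Set.univ ≠ ⊤
  diag : ∀ x t, qp x t {x} = 0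
  meas : ∀ B : Set X, MeasurableSet B → Measurable fun p : X × ℝ => qp p.1 p.2 B

namespace ConsQFun

variable {X : Type*} [MeasurableSpace X] {T₀ : ℝ} {T₁ : EReal}

/-- The jump rate `q(x,t) = q(x, t, X \ {x})`, as a real number. -/
def qrate (Q : ConsQFun X T₀ T₁) (x : X) (t : ℝ) : ℝ := (Q.qp x t Set.univ).toReal

/-- `q̄(x) = sup_{t ∈ [T₀,T₁)} q(x,t)`, computed in `ℝ≥0∞`. -/
def qbar (Q : ConsQFun X T₀ T₁) (x : X) : ℝ≥0∞ :=
  ⨆ t ∈ {t : ℝ | T₀ ≤ t ∧ (t : EReal) < T₁}, Q.qp x t Set.univ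

/-- Assumption (Feller): there are Borel sets `Bₙ ↑ X` with `sup_{x ∈ Bₙ} q̄(x) < n`
(for `n = 1, 2, …`; here reindexed by `n ↦ n + 1`). -/
def AssumptionFeller (Q : ConsQFun X T₀ T₁) : Prop :=
  ∃ B : ℕ → Set X, (∀ n, MeasurableSet (B n)) ∧ (∀ n, B n ⊆ B (n + 1)) ∧
    (⋃ n, B n) = Set.univ ∧ ∀ n : ℕ, (⨆ x ∈ B n, Q.qbar x) < (n : ℝ≥0∞) + 1

/-- Assumption (LB): `q̄(x) < ∞` for every `x`. -/
def AssumptionLB (Q : ConsQFun X T₀ T₁) : Prop := ∀ x, Q.qbar x < ⊤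

/-- Assumption (ALB): `sup_{t ∈ [T₀,s)} q(x,t) < ∞` for every `x` and `s ∈ (T₀,T₁)`. -/
def AssumptionALB (Q : ConsQFun X T₀ T₁) : Prop :=
  ∀ (x : X) (s : ℝ), T₀ < s → (s : EReal) < T₁ →
    (⨆ t ∈ Set.Ico T₀ s, Q.qp x t Set.univ) < ⊤

/-- Assumption (L1): `∫_{T₀}^s q(x,t) dt < ∞` for every `x` and `s ∈ (T₀,T₁)`. -/
def AssumptionL1 (Q : ConsQFun X T₀ T₁) : Prop :=
  ∀ (x : X) (s : ℝ), T₀ < s → (s : EReal) < T₁ →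
    ∫⁻ t in Set.Ico T₀ s, Q.qp x t Set.univ < ⊤

/-- A set `B` is `(q,s)`-bounded if `q(x,t)` is bounded on `B × [T₀, s)`; for `s = T₁`
this is the notion of a `q`-bounded set. -/
def QBddOn (Q : ConsQFun X T₀ T₁) (s : EReal) (B : Set X) : Prop :=
  ∃ C : ℝ≥0∞, C ≠ ⊤ ∧ ∀ x ∈ B, ∀ t : ℝ, T₀ ≤ t → (t : EReal) < s → Q.qp x t Set.univ ≤ C

/-- Feller's iterates: `P̄⁽⁰⁾(u,x;t,B) = 1{x∈B} e^{-∫_u^t q(x,s) ds}` and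
`P̄⁽ⁿ⁾(u,x;t,B) = ∫_u^t ∫_X e^{-∫_u^w q(x,θ) dθ} P̄⁽ⁿ⁻¹⁾(w,y;t,B) q(x,w,dy∖{x}) dw`
(the measure `q(x,w, ·∖{x})` is `Q.qp x w`, which has no atom at `x`). -/
def PbarN (Q : ConsQFun X T₀ T₁) : ℕ → ℝ → X → ℝ → Set X → ℝ≥0∞
  | 0 => fun u x t B =>
      B.indicator (fun _ => ENNReal.ofReal (Real.exp (-(∫ s in u..t, Q.qrate x s)))) x
  | n + 1 => fun u x t B =>
      ∫⁻ w in Set.Ioo u t,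
        ∫⁻ y, ENNReal.ofReal (Real.exp (-(∫ θ in u..w, Q.qrate x θ))) * Q.PbarN n w y t B
          ∂(Q.qp x w)

/-- The transition function `P̄(u,x;t,B) = Σ_{n=0}^∞ P̄⁽ⁿ⁾(u,x;t,B)`. -/
def Pbar (Q : ConsQFun X T₀ T₁) (u : ℝ) (x : X) (t : ℝ) (B : Set X) : ℝ≥0∞ :=
  ∑' n, Q.PbarN n u x t B

/-- `P̄` as a real-valued function. -/
def PbarR (Q : ConsQFun X T₀ T₁) (u : ℝ) (x : X) (t : ℝ) (B : Set X) : ℝ :=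
  (Q.Pbar u x t B).toReal

end ConsQFun

/-- A real-valued function `f` is absolutely continuous on a set `s ⊆ ℝ`: for every `ε > 0`
there is `δ > 0` such that for every finite collection of nonoverlapping intervals
`(aᵢ, bᵢ)` with endpoints in `s` and total length `< δ`, `Σ |f(bᵢ) - f(aᵢ)| < ε`. -/
def AbsContinuousOn (f : ℝ → ℝ) (s : Set ℝ) : Prop :=
  ∀ ε > (0 : ℝ), ∃ δ > (0 : ℝ), ∀ (n : ℕ) (a b : ℕ → ℝ),
    (∀ i, i < n → a i ∈ s ∧ b i ∈ s ∧ a i ≤ b i) →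
    (∀ i, i < n → ∀ j, j < n → i ≠ j → Disjoint (Set.Ioo (a i) (b i)) (Set.Ioo (a j) (b j))) →
    (∑ i ∈ Finset.range n, (b i - a i)) < δ →
    (∑ i ∈ Finset.range n, |f (b i) - f (a i)|) < ε

namespace ConsQFun

variable {X : Type*} [MeasurableSpace X] {T₀ : ℝ} {T₁ : EReal}

/-- The survival probability. -/
def surv (Q : ConsQFun X T₀ T₁) (u : ℝ) (x : X) (t : ℝ) : ℝ≥0∞ :=
  ENNReal.ofReal (Real.exp (-(∫ s in u..t, Q.qrate x s)))

lemma measurable_lintegral_qp (Q : ConsQFun X T₀ T₁) {α : Type*} [MeasurableSpace α]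
    {f : α × X → ℝ≥0∞} (hf : Measurable f) {g : α → X} (hg : Measurable g)
    {h : α → ℝ} (hh : Measurable h) :
    Measurable fun a => ∫⁻ y, f (a, y) ∂(Q.qp (g a) (h a)) := by
  have hm : ∀ B, MeasurableSet B → Measurable fun a => Q.qp (g a) (h a) B := fun B hB =>
    (Q.meas B hB).comp (hg.prodMk hh)
  let κ : ProbabilityTheory.Kernel α X :=
    { toFun := fun a => (Q.qp (g a) (h a) univ)⁻¹ • Q.qp (g a) (h a)
      measurable' := by
        refine Measure.measurable_of_measurable_coe _ fun B hB => ?_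
        simp only [Measure.smul_apply, smul_eq_mul]
        exact (hm univ .univ).inv.mul (hm B hB) }
  have hκ : ∀ a, κ a = (Q.qp (g a) (h a) univ)⁻¹ • Q.qp (g a) (h a) := fun a => rfl
  have : ProbabilityTheory.IsFiniteKernel κ := ⟨⟨1, by simp, fun a => by
    rw [hκ]
    simp only [Measure.smul_apply, smul_eq_mul]
    exact ENNReal.inv_mul_le_one _⟩⟩
  have key : (fun a => ∫⁻ y, f (a, y) ∂(Q.qp (g a) (h a))) =
      fun a => Q.qp (g a) (h a) univ * ∫⁻ y, f (a, y) ∂(κ a) := by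
    funext a
    rw [hκ, lintegral_smul_measure, smul_eq_mul, ← mul_assoc]
    by_cases h0 : Q.qp (g a) (h a) univ = 0
    · rw [Measure.measure_univ_eq_zero.1 h0]; simp
    · rw [ENNReal.mul_inv_cancel h0 (Q.fin _ _), one_mul]
  rw [key]
  exact (hm univ .univ).mul (Measurable.lintegral_kernel_prod_right' hf)

lemma measurable_qrate (Q : ConsQFun X T₀ T₁) :
    Measurable fun p : X × ℝ => Q.qrate p.1 p.2 := (Q.meas univ .univ).ennreal_toReal

lemma measurable_surv (Q : ConsQFun X T₀ T₁) :
    Measurable fun p : ℝ × X × ℝ => Q.surv p.1 p.2.1 p.2.2 := by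
  unfold surv
  refine ENNReal.measurable_ofReal.comp (Real.measurable_exp.comp (Measurable.neg ?_))
  unfold intervalIntegral
  have h1 : Measurable fun q : (ℝ × X × ℝ) × ℝ => Q.qrate q.1.2.1 q.2 :=
    Q.measurable_qrate.comp (by fun_prop : Measurable fun q : (ℝ × X × ℝ) × ℝ => (q.1.2.1, q.2))
  have key : ∀ a b : ℝ × X × ℝ → ℝ, Measurable a → Measurable b →
      Measurable fun p : ℝ × X × ℝ => ∫ s in Ioc (a p) (b p), Q.qrate p.2.1 s := by
    intro a b ha hb
    simp_rw [← integral_indicator measurableSet_Ioc]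
    refine (StronglyMeasurable.integral_prod_right' (ν := volume)
      (f := fun q : (ℝ × X × ℝ) × ℝ =>
        (Ioc (a q.1) (b q.1)).indicator (fun s => Q.qrate q.1.2.1 s) q.2) ?_).measurable
    refine Measurable.stronglyMeasurable ?_
    have hS : MeasurableSet {q : (ℝ × X × ℝ) × ℝ | a q.1 < q.2 ∧ q.2 ≤ b q.1} :=
      (measurableSet_lt (ha.comp measurable_fst) measurable_snd).inter
        (measurableSet_le measurable_snd (hb.comp measurable_fst))
    exact h1.indicator hS
  exact (key _ _ (by fun_prop) (by fun_prop)).sub (key _ _ (by fun_prop) (by fun_prop))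

lemma PbarN_zero (Q : ConsQFun X T₀ T₁) (u : ℝ) (x : X) (t : ℝ) (B : Set X) :
    Q.PbarN 0 u x t B = B.indicator (fun _ => Q.surv u x t) x := rfl

lemma PbarN_succ' (Q : ConsQFun X T₀ T₁) (n : ℕ) (u : ℝ) (x : X) (t : ℝ) (B : Set X) :
    Q.PbarN (n + 1) u x t B = ∫⁻ w in Ioo u t,
      ∫⁻ y, Q.surv u x w * Q.PbarN n w y t B ∂(Q.qp x w) := rfl

lemma surv_ne_top (Q : ConsQFun X T₀ T₁) (u : ℝ) (x : X) (t : ℝ) : Q.surv u x t ≠ ⊤ :=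
  ENNReal.ofReal_ne_top

lemma PbarN_succ (Q : ConsQFun X T₀ T₁) (n : ℕ) (u : ℝ) (x : X) (t : ℝ) (B : Set X) :
    Q.PbarN (n + 1) u x t B = ∫⁻ w in Ioo u t,
      Q.surv u x w * ∫⁻ y, Q.PbarN n w y t B ∂(Q.qp x w) := by
  rw [PbarN_succ']
  refine lintegral_congr fun w => ?_
  rw [lintegral_const_mul' _ _ (Q.surv_ne_top _ _ _)]

lemma measurable_PbarN (Q : ConsQFun X T₀ T₁) {B : Set X} (hB : MeasurableSet B) (n : ℕ) :
    Measurable fun p : ℝ × X × ℝ => Q.PbarN n p.1 p.2.1 p.2.2 B := by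
  induction n with
  | zero =>
    simp only [PbarN_zero]
    exact Q.measurable_surv.indicator
      (hB.preimage (by fun_prop : Measurable fun p : ℝ × X × ℝ => p.2.1))
  | succ n ih =>
    simp only [PbarN_succ]
    simp_rw [← lintegral_indicator measurableSet_Ioo]
    refine Measurable.lintegral_prod_right' (ν := volume)
      (f := fun q : (ℝ × X × ℝ) × ℝ => (Ioo q.1.1 q.1.2.2).indicator
        (fun w => Q.surv q.1.1 q.1.2.1 w *
          ∫⁻ y, Q.PbarN n w y q.1.2.2 B ∂(Q.qp q.1.2.1 w)) q.2) ?_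
    have hS : MeasurableSet {q : (ℝ × X × ℝ) × ℝ | q.1.1 < q.2 ∧ q.2 < q.1.2.2} :=
      (measurableSet_lt (by fun_prop) measurable_snd).inter
        (measurableSet_lt measurable_snd (by fun_prop))
    have h1 : Measurable fun q : (ℝ × X × ℝ) × ℝ => Q.surv q.1.1 q.1.2.1 q.2 :=
      Q.measurable_surv.comp
        (by fun_prop : Measurable fun q : (ℝ × X × ℝ) × ℝ => (q.1.1, q.1.2.1, q.2))
    have h2 : Measurable fun q : (ℝ × X × ℝ) × ℝ =>
        ∫⁻ y, Q.PbarN n q.2 y q.1.2.2 B ∂(Q.qp q.1.2.1 q.2) :=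
      Q.measurable_lintegral_qp (f := fun r : ((ℝ × X × ℝ) × ℝ) × X =>
        Q.PbarN n r.1.2 r.2 r.1.1.2.2 B)
        (ih.comp (by fun_prop : Measurable fun r : ((ℝ × X × ℝ) × ℝ) × X =>
          (r.1.2, r.2, r.1.1.2.2))) (by fun_prop) (by fun_prop)
    exact (h1.mul h2).indicator hS

/-- The iterates as measures. -/
def muN (Q : ConsQFun X T₀ T₁) : ℕ → ℝ → X → ℝ → Measure X
  | 0 => fun u x t => Q.surv u x t • Measure.dirac x
  | n + 1 => fun u x t => (volume.restrict (Ioo u t)).bind fun w =>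
      Q.surv u x w • (Q.qp x w).bind fun y => Q.muN n w y t

lemma measurable_muN_aux (Q : ConsQFun X T₀ T₁) (n : ℕ)
    (h : ∀ u x t, ∀ B, MeasurableSet B → Q.muN n u x t B = Q.PbarN n u x t B) (w t : ℝ) :
    Measurable fun y => Q.muN n w y t := by
  refine Measure.measurable_of_measurable_coe _ fun B hB => ?_
  simp only [h _ _ _ B hB]
  exact (Q.measurable_PbarN hB n).comp (by fun_prop : Measurable fun y : X => (w, y, t))

lemma measurable_inner (Q : ConsQFun X T₀ T₁) (n : ℕ) (u : ℝ) (x : X) (t : ℝ)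
    {B : Set X} (hB : MeasurableSet B) :
    Measurable fun w : ℝ => Q.surv u x w * ∫⁻ y, Q.PbarN n w y t B ∂(Q.qp x w) := by
  have h0 : Measurable fun w : ℝ => ((u, x, w) : ℝ × X × ℝ) :=
    measurable_const.prodMk (measurable_const.prodMk measurable_id)
  have h1 : Measurable fun w : ℝ => Q.surv u x w := by
    have h3 := Q.measurable_surv.comp h0
    simpa only [Function.comp_def] using h3
  have h2 : Measurable fun w : ℝ => ∫⁻ y, Q.PbarN n w y t B ∂(Q.qp x w) :=
    Q.measurable_lintegral_qp (f := fun r : ℝ × X => Q.PbarN n r.1 r.2 t B)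
      (g := fun _ => x) (h := fun w => w)
      ((Q.measurable_PbarN hB n).comp (by fun_prop : Measurable fun r : ℝ × X => (r.1, r.2, t)))
      measurable_const measurable_id
  exact h1.mul h2

lemma inner_apply (Q : ConsQFun X T₀ T₁) (n : ℕ)
    (h : ∀ u x t, ∀ B, MeasurableSet B → Q.muN n u x t B = Q.PbarN n u x t B)
    (u : ℝ) (x : X) (t : ℝ) {B : Set X} (hB : MeasurableSet B) (w : ℝ) :
    (Q.surv u x w • (Q.qp x w).bind fun y => Q.muN n w y t) B =
      Q.surv u x w * ∫⁻ y, Q.PbarN n w y t B ∂(Q.qp x w) := by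
  rw [Measure.smul_apply, Measure.bind_apply hB (Q.measurable_muN_aux n h w t).aemeasurable,
    smul_eq_mul]
  congr 1
  exact lintegral_congr fun y => h _ _ _ B hB

lemma measurable_muN_aux2 (Q : ConsQFun X T₀ T₁) (n : ℕ)
    (h : ∀ u x t, ∀ B, MeasurableSet B → Q.muN n u x t B = Q.PbarN n u x t B)
    (u : ℝ) (x : X) (t : ℝ) :
    Measurable fun w => Q.surv u x w • (Q.qp x w).bind fun y => Q.muN n w y t := by
  refine Measure.measurable_of_measurable_coe _ fun B hB => ?_
  simp only [Q.inner_apply n h u x t hB]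
  exact Q.measurable_inner n u x t hB

lemma muN_apply (Q : ConsQFun X T₀ T₁) (n : ℕ) : ∀ u x t, ∀ B, MeasurableSet B →
    Q.muN n u x t B = Q.PbarN n u x t B := by
  induction n with
  | zero =>
    intro u x t B hB
    rw [PbarN_zero]
    simp only [muN, Measure.smul_apply, smul_eq_mul, Measure.dirac_apply' _ hB]
    by_cases hx : x ∈ B <;> simp [hx]
  | succ n ih =>
    intro u x t B hB
    rw [PbarN_succ]
    simp only [muN]
    rw [Measure.bind_apply hB (Q.measurable_muN_aux2 n ih u x t).aemeasurable]
    refine lintegral_congr fun w => ?_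
    rw [Measure.smul_apply, Measure.bind_apply hB (Q.measurable_muN_aux n ih w t).aemeasurable]
    simp only [ih _ _ _ B hB, smul_eq_mul]

lemma lintegral_muN_zero (Q : ConsQFun X T₀ T₁) (u : ℝ) (x : X) (t : ℝ)
    {f : X → ℝ≥0∞} (hf : Measurable f) :
    ∫⁻ y, f y ∂(Q.muN 0 u x t) = Q.surv u x t * f x := by
  simp only [muN]
  rw [lintegral_smul_measure, lintegral_dirac' _ hf, smul_eq_mul]

lemma lintegral_muN_succ (Q : ConsQFun X T₀ T₁) (n : ℕ) (u : ℝ) (x : X) (t : ℝ)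
    {f : X → ℝ≥0∞} (hf : Measurable f) :
    ∫⁻ y, f y ∂(Q.muN (n + 1) u x t) = ∫⁻ w in Ioo u t,
      Q.surv u x w * ∫⁻ y, ∫⁻ z, f z ∂(Q.muN n w y t) ∂(Q.qp x w) := by
  simp only [muN]
  rw [Measure.lintegral_bind (Q.measurable_muN_aux2 n (Q.muN_apply n) u x t).aemeasurable
    hf.aemeasurable]
  refine lintegral_congr fun w => ?_
  rw [lintegral_smul_measure, smul_eq_mul, Measure.lintegral_bind
    (Q.measurable_muN_aux n (Q.muN_apply n) w t).aemeasurable hf.aemeasurable]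

lemma measurable_lintegral_muN (Q : ConsQFun X T₀ T₁) (n : ℕ) (w t : ℝ)
    {f : X → ℝ≥0∞} (hf : Measurable f) :
    Measurable fun y => ∫⁻ z, f z ∂(Q.muN n w y t) :=
  (Measure.measurable_lintegral hf).comp (Q.measurable_muN_aux n (Q.muN_apply n) w t)

lemma measurable_lintegral_muN2 (Q : ConsQFun X T₀ T₁) (n : ℕ) (u : ℝ) (x : X) (t : ℝ)
    {f : X → ℝ≥0∞} (hf : Measurable f) :
    Measurable fun w => Q.surv u x w * ∫⁻ y, ∫⁻ z, f z ∂(Q.muN n w y t) ∂(Q.qp x w) := by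
  have h := (Measure.measurable_lintegral hf).comp
    (Q.measurable_muN_aux2 n (Q.muN_apply n) u x t)
  convert h using 2 with w
  simp only [Function.comp]
  rw [lintegral_smul_measure, smul_eq_mul, Measure.lintegral_bind
    (Q.measurable_muN_aux n (Q.muN_apply n) w t).aemeasurable hf.aemeasurable]

lemma intervalIntegrable_qrate (Q : ConsQFun X T₀ T₁) (hL1 : Q.AssumptionL1) (x : X)
    {u t : ℝ} (hu : T₀ ≤ u) (hut : u ≤ t) (ht : (t : EReal) < T₁) :
    IntervalIntegrable (fun s => Q.qrate x s) volume u t := by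
  rcases hut.eq_or_lt with rfl | hut
  · simp
  rw [intervalIntegrable_iff_integrableOn_Ico_of_le hut.le]
  have hm : Measurable fun s => Q.qp x s univ :=
    (Q.meas univ .univ).comp (by fun_prop : Measurable fun s : ℝ => (x, s))
  have : IntegrableOn (fun s => Q.qrate x s) (Ico T₀ t) volume :=
    integrable_toReal_of_lintegral_ne_top hm.aemeasurable
      (hL1 x t (hu.trans_lt hut) ht).ne
  exact this.mono_set (Ico_subset_Ico_left hu)

lemma surv_mul (Q : ConsQFun X T₀ T₁) (hL1 : Q.AssumptionL1) (x : X)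
    {u s t : ℝ} (hu : T₀ ≤ u) (hus : u ≤ s) (hst : s ≤ t) (ht : (t : EReal) < T₁) :
    Q.surv u x t = Q.surv u x s * Q.surv s x t := by
  have hs : (s : EReal) < T₁ := lt_of_le_of_lt (by exact_mod_cast hst) ht
  unfold surv
  rw [← intervalIntegral.integral_add_adjacent_intervals
    (Q.intervalIntegrable_qrate hL1 x hu hus hs)
    (Q.intervalIntegrable_qrate hL1 x (hu.trans hus) hst ht),
    ← ENNReal.ofReal_mul (Real.exp_pos _).le, ← Real.exp_add, neg_add]

lemma surv_integral_le (Q : ConsQFun X T₀ T₁) (hL1 : Q.AssumptionL1) (x : X)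
    {u t : ℝ} (hu : T₀ ≤ u) (hut : u ≤ t) (ht : (t : EReal) < T₁) :
    Q.surv u x t + ∫⁻ w in Ioo u t, Q.surv u x w * Q.qp x w univ ≤ 1 := by
  have hI := Q.intervalIntegrable_qrate hL1 x hu hut ht
  set f : ℝ → ℝ := fun w => -Real.exp (-(∫ s in u..w, Q.qrate x s)) with hf
  have hmono : MonotoneOn f (Icc u t) := by
    intro a ha b hb hab
    have h1 : ∫ s in u..a, Q.qrate x s ≤ ∫ s in u..b, Q.qrate x s := by
      refine intervalIntegral.integral_mono_interval le_rfl ha.1 hab ?_ ?_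
      · exact Eventually.of_forall fun s => ENNReal.toReal_nonneg
      · exact hI.mono_set (by rw [uIcc_of_le hb.1, uIcc_of_le hut]; exact Icc_subset_Icc_right hb.2)
    simp only [hf]
    gcongr
  obtain ⟨G, hG1, hG2, hG3⟩ := hmono.exists_tendsto_deriv_liminf_lintegral_enorm_le hut
  have hder := hI.ae_hasDerivAt_integral
  have hle : ∫⁻ w in Ioo u t, Q.surv u x w * Q.qp x w univ ≤ ENNReal.ofReal (f t - f u) := by
    calc ∫⁻ w in Ioo u t, Q.surv u x w * Q.qp x w univ
        ≤ ∫⁻ w in Icc u t, Q.surv u x w * Q.qp x w univ :=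
          lintegral_mono_set Ioo_subset_Icc_self
      _ = ∫⁻ w in Icc u t, ‖deriv f w‖ₑ := by
          refine lintegral_congr_ae ?_
          filter_upwards [ae_restrict_of_ae hder, ae_restrict_mem measurableSet_Icc] with w hw hwm
          rw [uIcc_of_le hut] at hw
          have h2 := (hw hwm u ⟨le_rfl, hut⟩).neg.exp.neg
          have h3 : deriv f w = Real.exp (-(∫ s in u..w, Q.qrate x s)) * Q.qrate x w := by
            refine h2.deriv.trans ?_
            rw [mul_neg, neg_neg]
            rfl
          rw [h3, qrate, Real.enorm_eq_ofReal (mul_nonneg (Real.exp_pos _).le ENNReal.toReal_nonneg),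
            ENNReal.ofReal_mul (Real.exp_pos _).le, ENNReal.ofReal_toReal (Q.fin _ _)]
          rfl
      _ ≤ ∫⁻ w in Icc u t, liminf (fun n => ‖G n w‖ₑ) atTop := by
          refine lintegral_mono_ae ?_
          filter_upwards [hG1] with w hw
          exact (hw.enorm.liminf_eq).ge
      _ ≤ liminf (fun n => ∫⁻ w in Icc u t, ‖G n w‖ₑ) atTop :=
          lintegral_liminf_le' fun n => (hG2 n).enorm
      _ ≤ _ := hG3
  calc _ ≤ Q.surv u x t + ENNReal.ofReal (f t - f u) := by gcongr
    _ = ENNReal.ofReal 1 := by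
      unfold surv
      rw [← ENNReal.ofReal_add (Real.exp_pos _).le (sub_nonneg.2 (hmono ⟨le_rfl, hut⟩ ⟨hut, le_rfl⟩ hut))]
      congr 1
      simp [hf]
    _ ≤ 1 := by simp

lemma sum_PbarN_le (Q : ConsQFun X T₀ T₁) (hL1 : Q.AssumptionL1) {t : ℝ} (ht : (t : EReal) < T₁)
    {B : Set X} (hB : MeasurableSet B) (N : ℕ) :
    ∀ (u : ℝ) (x : X), T₀ ≤ u → u ≤ t → ∑ n ∈ Finset.range N, Q.PbarN n u x t B ≤ 1 := by
  induction N with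
  | zero => intro u x _ _; simp
  | succ N ih =>
    intro u x hu hut
    refine le_trans ?_ (Q.surv_integral_le hL1 x hu hut ht)
    rw [Finset.sum_range_succ', add_comm]
    refine add_le_add ?_ ?_
    · rw [PbarN_zero]
      exact indicator_le_self _ _ _
    · have hy : ∀ n w, Measurable fun y => Q.PbarN n w y t B := fun n w =>
        (Q.measurable_PbarN hB n).comp (by fun_prop : Measurable fun y : X => (w, y, t))
      have hw : ∀ n, Measurable fun w : ℝ =>
          Q.surv u x w * ∫⁻ y, Q.PbarN n w y t B ∂(Q.qp x w) := fun n =>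
        (Q.measurable_surv.comp (by fun_prop : Measurable fun w : ℝ => (u, x, w))).mul
        (Q.measurable_lintegral_qp (f := fun r : ℝ × X => Q.PbarN n r.1 r.2 t B)
          ((Q.measurable_PbarN hB n).comp
            (by fun_prop : Measurable fun r : ℝ × X => (r.1, r.2, t)))
          measurable_const measurable_id)
      simp only [PbarN_succ]
      rw [← lintegral_finsetSum _ fun n _ => hw n]
      refine setLIntegral_mono' measurableSet_Ioo fun w hwm => ?_
      rw [← Finset.mul_sum, ← lintegral_finsetSum _ fun n _ => hy n w]
      gcongr
      calc _ ≤ ∫⁻ y, 1 ∂(Q.qp x w) :=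
            lintegral_mono fun y => ih w y (hu.trans hwm.1.le) hwm.2.le
        _ = _ := by simp

lemma Pbar_le_one (Q : ConsQFun X T₀ T₁) (hL1 : Q.AssumptionL1) {u t : ℝ} (x : X)
    (hu : T₀ ≤ u) (hut : u ≤ t) (ht : (t : EReal) < T₁)
    {B : Set X} (hB : MeasurableSet B) : Q.Pbar u x t B ≤ 1 := by
  unfold Pbar
  rw [ENNReal.tsum_eq_iSup_nat]
  exact iSup_le fun N => Q.sum_PbarN_le hL1 ht hB N u x hu hut

lemma PbarN_CK (Q : ConsQFun X T₀ T₁) (hL1 : Q.AssumptionL1) {s t : ℝ} (hst : s < t)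
    (ht : (t : EReal) < T₁) {B : Set X} (hB : MeasurableSet B) (n : ℕ) :
    ∀ (u : ℝ) (x : X), T₀ ≤ u → u < s → Q.PbarN n u x t B =
      ∑ k ∈ Finset.range (n + 1), ∫⁻ y, Q.PbarN (n - k) s y t B ∂(Q.muN k u x s) := by
  have hy : ∀ n w, Measurable fun y => Q.PbarN n w y t B := fun n w =>
    (Q.measurable_PbarN hB n).comp (by fun_prop : Measurable fun y : X => (w, y, t))
  induction n with
  | zero =>
    intro u x hu hus
    simp only [zero_add, Finset.range_one, Finset.sum_singleton, Nat.sub_self]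
    rw [lintegral_muN_zero _ _ _ _ (hy 0 s), PbarN_zero, PbarN_zero,
      Q.surv_mul hL1 x hu hus.le hst.le ht]
    by_cases hx : x ∈ B <;> simp [hx]
  | succ n ih =>
    intro u x hu hus
    rw [Finset.sum_range_succ', Nat.sub_zero, lintegral_muN_zero _ _ _ _ (hy (n+1) s)]
    have hsplit : Ioo u t = Ioo u s ∪ Ico s t := (Ioo_union_Ico_eq_Ioo hus hst.le).symm
    rw [PbarN_succ, hsplit, lintegral_union measurableSet_Ico
      (by
        rw [Set.disjoint_left]
        intro a ha hb
        exact absurd ha.2 (not_lt.2 hb.1))]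
    congr 1
    · simp only [lintegral_muN_succ _ _ _ _ _ (hy _ s)]
      rw [← lintegral_finsetSum _ fun k _ => Q.measurable_lintegral_muN2 k u x s (hy _ s)]
      refine setLIntegral_congr_fun measurableSet_Ioo fun w hw => ?_
      rw [← Finset.mul_sum, ← lintegral_finsetSum _ fun k _ =>
        Q.measurable_lintegral_muN k w s (hy _ s)]
      congr 1
      refine lintegral_congr fun y => ?_
      rw [ih w y (hu.trans hw.1.le) hw.2]
      refine Finset.sum_congr rfl fun k _ => ?_
      rw [Nat.add_sub_add_right]
    · rw [PbarN_succ, ← lintegral_const_mul' _ _ (Q.surv_ne_top _ _ _),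
        setLIntegral_congr Ioo_ae_eq_Ico.symm]
      refine setLIntegral_congr_fun measurableSet_Ioo fun w hw => ?_
      rw [Q.surv_mul hL1 x hu hus.le hw.1.le (lt_trans (by exact_mod_cast hw.2) ht), mul_assoc]

lemma tsum_antidiag (f : ℕ → ℕ → ℝ≥0∞) :
    ∑' n, ∑ k ∈ Finset.range (n + 1), f k (n - k) = ∑' k, ∑' m, f k m := by
  simp_rw [← Finset.Nat.sum_antidiagonal_eq_sum_range_succ f]
  rw [← ENNReal.tsum_prod, ← Finset.HasAntidiagonal.sigmaAntidiagonalEquivProd.tsum_eq,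
    ENNReal.tsum_sigma']
  refine tsum_congr fun n => ?_
  rw [tsum_fintype]
  exact (Finset.sum_coe_sort (Finset.HasAntidiagonal.antidiagonal n) fun p : ℕ × ℕ => f p.1 p.2).symm

lemma sum_muN_apply (Q : ConsQFun X T₀ T₁) (u : ℝ) (x : X) (t : ℝ) (B : Set X)
    (hB : MeasurableSet B) :
    Measure.sum (fun n => Q.muN n u x t) B = Q.Pbar u x t B := by
  rw [Measure.sum_apply _ hB]
  exact tsum_congr fun n => Q.muN_apply n u x t B hB

end ConsQFun

/-- Theorem 1 of Feinberg–Mandava–Shiryaev: under Assumption L1, `P̄` is a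
transition function: (i) `P̄(u,x;t,·)` is a measure with values in `[0,1]`; (ii) for each
Borel `B`, `(u,x,t) ↦ P̄(u,x;t,B)` is Borel measurable on the domain
`{(u,x,t) : T₀ ≤ u < t, t < T₁}`; (iii) the Chapman–Kolmogorov equation
`P̄(u,x;t,B) = ∫_X P̄(s,y;t,B) P̄(u,x;s,dy)` holds for `u < s < t` (the integration with
respect to `P̄(u,x;s,dy)` being expressed via any measure `μ` agreeing with `P̄(u,x;s,·)` on
Borel sets). -/
theorem pbar_is_transition_function
    {X : Type*} [MeasurableSpace X] [StandardBorelSpace X]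
    {T₀ : ℝ} {T₁ : EReal} (hT : (T₀ : EReal) < T₁)
    (Q : ConsQFun X T₀ T₁) (hL1 : Q.AssumptionL1) :
    (∀ (u t : ℝ) (x : X), T₀ ≤ u → u < t → (t : EReal) < T₁ →
      (∀ B : Set X, MeasurableSet B → Q.Pbar u x t B ≤ 1) ∧
        ∃ μ : Measure X, ∀ B : Set X, MeasurableSet B → μ B = Q.Pbar u x t B) ∧
    (∀ B : Set X, MeasurableSet B →
      Measurable fun p : {p : ℝ × X × ℝ // T₀ ≤ p.1 ∧ p.1 < p.2.2 ∧ ((p.2.2 : ℝ) : EReal) < T₁} =>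
        Q.Pbar p.1.1 p.1.2.1 p.1.2.2 B) ∧
    (∀ (u s t : ℝ) (x : X) (B : Set X), T₀ ≤ u → u < s → s < t → (t : EReal) < T₁ →
      MeasurableSet B →
      ∀ μ : Measure X, (∀ C : Set X, MeasurableSet C → μ C = Q.Pbar u x s C) →
        Q.Pbar u x t B = ∫⁻ y, Q.Pbar s y t B ∂μ) := by
  refine ⟨fun u t x hu hut ht => ⟨fun B hB => Q.Pbar_le_one hL1 x hu hut.le ht hB,
    Measure.sum (fun n => Q.muN n u x t), Q.sum_muN_apply u x t⟩, fun B hB => ?_, ?_⟩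
  · have h : Measurable fun p : ℝ × X × ℝ => Q.Pbar p.1 p.2.1 p.2.2 B :=
      Measurable.tsum fun n => Q.measurable_PbarN hB n
    exact h.comp measurable_subtype_coe
  · intro u s t x B hu hus hst ht hB μ hμ
    have hμ' : μ = Measure.sum (fun n => Q.muN n u x s) :=
      Measure.ext fun C hC => by rw [hμ C hC, Q.sum_muN_apply u x s C hC]
    have hy : ∀ n w, Measurable fun y => Q.PbarN n w y t B := fun n w =>
      (Q.measurable_PbarN hB n).comp (by fun_prop : Measurable fun y : X => (w, y, t))
    rw [hμ', lintegral_sum_measure]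
    simp only [ConsQFun.Pbar]
    simp_rw [lintegral_tsum fun n => (hy n s).aemeasurable]
    rw [← ConsQFun.tsum_antidiag fun k m => ∫⁻ y, Q.PbarN m s y t B ∂(Q.muN k u x s)]
    exact tsum_congr fun n => Q.PbarN_CK hL1 hst ht hB n u x hu hus
end
end

section
/- Let q be a conservative Q-function satisfying Assumption LB. A function P ∈ 𝒫̂ satisfies the two properties: (i) for all u ∈ [T₀,T₁), s ∈ (u,T₁), x ∈ X, and (q,s)-bounded sets B, lim_{t→u+} P(u,x;t,B) = 1{x∈B} and t ↦ P(u,x;t,B) is absolutely continuous on (u,s); and (ii) for all such u, s, x, B, Kolmogorov's forward equation holds for almost every t ∈ (u,s) — if and only if the following two properties hold: (a) for all u ∈ [T₀,T₁), x ∈ X, and q-bounded sets B, lim_{t→u+} P(u,x;t,B) = 1{x∈B} and t ↦ P(u,x;t,B) is absolutely continuous on (u,s) for each s ∈ (u,T₁); and (b) for all u ∈ [T₀,T₁), x ∈ X, and q-bounded sets B, Kolmogorov's forward equation (∂/∂t)P(u,x;t,B) = −∫_B q(y,t) P(u,x;t,dy) + ∫_X q(y,t,B∖{y}) P(u,x;t,dy)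 holds for almost every t ∈ (u,T₁). -/
open MeasureTheory Set Filter Topology
open scoped ENNReal

noncomputable section

/-- Borel separation of a sequence of sets (Novikov). -/
def NSep {α : Type*} [MeasurableSpace α] (A : ℕ → Set α) : Prop :=
  ∃ C : ℕ → Set α, (∀ n, MeasurableSet (C n)) ∧ (∀ n, A n ⊆ C n) ∧ ∀ x, ∃ n, x ∉ C n

lemma NSep.split {α : Type*} [MeasurableSpace α] (A : ℕ → Set α) (D : ℕ → ℕ → Set α) (n0 : ℕ)
    (h1 : ∀ k n, n ≠ n0 → A n ⊆ D k n) (h2 : A n0 ⊆ ⋃ k, D k n0)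
    (h : ∀ k, NSep (D k)) : NSep A := by
  classical
  choose C hCm hC hCe using h
  refine ⟨fun n => if n = n0 then ⋃ k, C k n else ⋂ k, C k n, ?_, ?_, ?_⟩
  · intro n
    dsimp only
    split_ifs
    · exact MeasurableSet.iUnion fun k => hCm k n
    · exact MeasurableSet.iInter fun k => hCm k n
  · intro n
    dsimp only
    split_ifs with hn
    · subst hn
      exact h2.trans (iUnion_mono fun k => hC k n)
    · exact subset_iInter fun k => (h1 k n hn).trans (hC k n)
  · intro x
    by_contra! hx
    have h0 := hx n0
    simp only [if_true, mem_iUnion] at h0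
    obtain ⟨k, hk⟩ := h0
    obtain ⟨n, hn⟩ := hCe k x
    by_cases hnn : n = n0
    · subst hnn; exact hn hk
    · have := hx n
      simp only [hnn, if_false, mem_iInter] at this
      exact hn (this k)

open PiNat in
lemma novikov_range {α : Type*} [TopologicalSpace α] [T2Space α] [MeasurableSpace α]
    [OpensMeasurableSpace α] (f : ℕ → (ℕ → ℕ) → α) (hf : ∀ n, Continuous (f n))
    (h : ∀ x, ∃ n, x ∉ range (f n)) : NSep fun n => range (f n) := by
  by_contra hns
  let g : ℕ → (ℕ → ℕ) → α := fun n y => f n (fun i => y (Nat.pair n i))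
  have hg : ∀ n, Continuous (g n) := fun n =>
    (hf n).comp (continuous_pi fun i => continuous_apply _)
  let S : ℕ → (ℕ → ℕ) → ℕ → Set α := fun m y n => g n '' cylinder y m
  have step : ∀ m y, ¬ NSep (S m y) → ∃ k, ¬ NSep (S (m+1) (Function.update y m k)) := by
    intro m y
    contrapose!
    intro H
    refine NSep.split (S m y) (fun k => S (m+1) (Function.update y m k)) (Nat.unpair m).1 ?_ ?_ H
    · rintro k n hn _ ⟨z, hz, rfl⟩
      refine ⟨Function.update z m k, ?_, ?_⟩
      · rw [mem_cylinder_iff] at hz ⊢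
        intro i hi
        by_cases him : i = m
        · subst him; simp
        · simp only [Function.update_of_ne him]
          exact hz i (by omega)
      · change f n _ = f n _
        congr 1
        ext i
        rw [Function.update_of_ne]
        rintro rfl
        simp at hn
    · rw [← image_iUnion]
      exact image_mono (iUnion_cylinder_update (E := fun _ => ℕ) y m).superset
  let B := { p : ℕ × (ℕ → ℕ) // ¬ NSep (S p.1 p.2) }
  have : ∀ p : B, ∃ q : B, q.1.1 = p.1.1 + 1 ∧ q.1.2 ∈ cylinder p.1.2 p.1.1 := by
    rintro ⟨⟨n, y⟩, hp⟩
    obtain ⟨k, hk⟩ := step n y hp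
    exact ⟨⟨⟨n + 1, _⟩, hk⟩, rfl, update_mem_cylinder _ _ _⟩
  choose F hFn hFx using this
  have hr : ∀ n, range (f n) = range (g n) := by
    intro n
    apply Subset.antisymm
    · rintro _ ⟨z, rfl⟩
      refine ⟨fun j => z (Nat.unpair j).2, ?_⟩
      simp [g]
    · rintro _ ⟨z, rfl⟩
      exact ⟨_, rfl⟩
  let p0 : B := ⟨⟨0, fun _ => 0⟩, by
    intro h0; apply hns
    simp only [hr]
    simpa [S] using h0⟩
  let p : ℕ → B := fun n => F^[n] p0
  have prec : ∀ n, p (n + 1) = F (p n) := fun n => by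
    simp only [p, Function.iterate_succ', Function.comp]
  have pn_fst : ∀ n, (p n).1.1 = n := fun n ↦ by
    induction n with
    | zero => rfl
    | succ n IH => simp only [prec, hFn, IH]
  have Ix : ∀ m n, m + 1 ≤ n → (p n).1.2 m = (p (m + 1)).1.2 m := by
    intro m
    apply Nat.le_induction
    · rfl
    intro n hmn IH
    have I : (F (p n)).val.snd m = (p n).val.snd m := by
      apply hFx (p n) m
      rw [pn_fst]
      exact hmn
    rw [prec, I, IH]
  set y : ℕ → ℕ := fun n => (p (n + 1)).1.2 n with hy
  have M : ∀ n, ¬ NSep (S n y) := by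
    intro n
    have e : S n y = S (p n).1.1 (p n).1.2 := by
      have : cylinder y n = cylinder (p n).1.2 n := by
        rw [← mem_cylinder_iff_eq, mem_cylinder_iff]
        intro i hi
        exact (Ix i n hi).symm
      rw [pn_fst]
      simp only [S, this]
    rw [e]
    exact (p n).2
  have hex : ∃ i, g i y ≠ g 0 y := by
    by_contra! hc
    obtain ⟨n, hn⟩ := h (g 0 y)
    apply hn
    rw [hr, ← hc n]
    exact ⟨y, rfl⟩
  obtain ⟨i, hi⟩ := hex
  obtain ⟨U, V, hU, hV, hiU, h0V, hUV⟩ := t2_separation hi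
  let _ : MetricSpace (ℕ → ℕ) := metricSpaceNatNat
  obtain ⟨εx, εxpos, hεx⟩ : ∃ (εx : ℝ), εx > 0 ∧ Metric.ball y εx ⊆ g i ⁻¹' U := by
    apply Metric.mem_nhds_iff.1
    exact (hg i).continuousAt.preimage_mem_nhds (hU.mem_nhds hiU)
  obtain ⟨εy, εypos, hεy⟩ : ∃ (εy : ℝ), εy > 0 ∧ Metric.ball y εy ⊆ g 0 ⁻¹' V := by
    apply Metric.mem_nhds_iff.1
    exact (hg 0).continuousAt.preimage_mem_nhds (hV.mem_nhds h0V)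
  obtain ⟨n, hn⟩ : ∃ n : ℕ, (1 / 2 : ℝ) ^ n < min εx εy :=
    exists_pow_lt_of_lt_one (lt_min εxpos εypos) (by norm_num)
  have hi0 : i ≠ 0 := by rintro rfl; exact hi rfl
  refine M n ⟨fun j => if j = i then U else if j = 0 then V else univ, ?_, ?_, ?_⟩
  · intro j
    dsimp only
    split_ifs
    exacts [hU.measurableSet, hV.measurableSet, MeasurableSet.univ]
  · intro j
    dsimp only
    split_ifs with h1 h2
    · subst h1
      rw [image_subset_iff]
      refine Subset.trans ?_ hεx
      intro z hz
      rw [mem_cylinder_iff_dist_le] at hz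
      exact hz.trans_lt (hn.trans_le (min_le_left _ _))
    · subst h2
      rw [image_subset_iff]
      refine Subset.trans ?_ hεy
      intro z hz
      rw [mem_cylinder_iff_dist_le] at hz
      exact hz.trans_lt (hn.trans_le (min_le_right _ _))
    · exact subset_univ _
  · intro x
    by_contra! hx
    have h1 := hx i
    have h2 := hx 0
    simp [hi0.symm] at h1 h2
    exact disjoint_left.1 hUV h1 h2

lemma novikov {α : Type*} [TopologicalSpace α] [T2Space α] [MeasurableSpace α]
    [OpensMeasurableSpace α] (A : ℕ → Set α) (hA : ∀ n, AnalyticSet (A n))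
    (h : ∀ x, ∃ n, x ∉ A n) : NSep A := by
  classical
  by_cases he : ∃ n, A n = ∅
  · obtain ⟨n, hn⟩ := he
    refine ⟨fun j => if j = n then ∅ else univ, ?_, ?_, ?_⟩
    · intro j
      dsimp only
      split_ifs <;> simp
    · intro j
      dsimp only
      split_ifs with hj
      · subst hj; exact hn.subset
      · exact subset_univ _
    · intro x
      exact ⟨n, by simp⟩
  · push Not at he
    have : ∀ n, ∃ f : (ℕ → ℕ) → α, Continuous f ∧ range f = A n := by
      intro n
      have := hA n
      rw [AnalyticSet] at this
      exact this.resolve_left (he n).ne_empty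
    choose f hf hfr using this
    have := novikov_range f hf (by simpa only [hfr] using h)
    simpa only [hfr] using this

/-- Under LB there is a countable increasing exhaustion by `q`-bounded Borel sets. -/
lemma exists_exhaustion {X : Type*} [MeasurableSpace X] [StandardBorelSpace X]
    {T₀ : ℝ} {T₁ : EReal} (Q : ConsQFun X T₀ T₁) (hLB : Q.AssumptionLB) :
    ∃ E : ℕ → Set X, (∀ n, MeasurableSet (E n)) ∧ Monotone E ∧ (∀ x, ∃ n, x ∈ E n) ∧
      ∀ n, Q.QBddOn T₁ (E n) := by
  let := upgradeStandardBorel X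
  let A : ℕ → Set X := fun n =>
    Prod.fst '' {p : X × ℝ | (T₀ ≤ p.2 ∧ (p.2 : EReal) < T₁) ∧ (n : ℝ≥0∞) < Q.qp p.1 p.2 univ}
  have hA : ∀ n, AnalyticSet (A n) := by
    intro n
    apply MeasurableSet.analyticSet_image _ measurable_fst
    refine MeasurableSet.inter ?_ ?_
    · refine MeasurableSet.inter ?_ ?_
      · exact measurableSet_le measurable_const measurable_snd
      · exact measurableSet_lt (measurable_coe_real_ereal.comp measurable_snd) measurable_const
    · exact measurableSet_lt measurable_const (Q.meas univ MeasurableSet.univ)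
  have hle : ∀ x t, T₀ ≤ t → (t : EReal) < T₁ → Q.qp x t univ ≤ Q.qbar x := by
    intro x t h1 h2
    exact le_iSup₂_of_le (f := fun t (_ : t ∈ {t : ℝ | T₀ ≤ t ∧ (t : EReal) < T₁}) =>
      Q.qp x t univ) t ⟨h1, h2⟩ le_rfl
  obtain ⟨C, hCm, hC, hCe⟩ := novikov A hA (by
    intro x
    obtain ⟨n, hn⟩ := ENNReal.exists_nat_gt (hLB x).ne
    refine ⟨n, ?_⟩
    rintro ⟨⟨x', t⟩, ⟨⟨h1, h2⟩, h3⟩, rfl⟩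
    exact absurd (h3.trans_le (hle _ _ h1 h2)) (not_lt.2 hn.le))
  refine ⟨fun n => ⋃ k ∈ Finset.range (n+1), (C k)ᶜ, ?_, ?_, ?_, ?_⟩
  · intro n
    exact Finset.measurableSet_biUnion _ fun k _ => (hCm k).compl
  · intro m n hmn
    apply biUnion_subset_biUnion_left
    intro k hk
    simp at hk ⊢
    omega
  · intro x
    obtain ⟨n, hn⟩ := hCe x
    exact ⟨n, mem_biUnion (x := n) (by simp) hn⟩
  · intro n
    refine ⟨n, ENNReal.natCast_ne_top n, ?_⟩
    intro x hx t h1 h2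
    simp only [mem_iUnion, Finset.mem_range] at hx
    obtain ⟨k, hk, hx⟩ := hx
    by_contra! hlt
    apply hx
    apply hC k
    refine ⟨(x, t), ⟨⟨h1, h2⟩, lt_of_le_of_lt ?_ hlt⟩, rfl⟩
    exact_mod_cast Nat.lt_succ_iff.1 hk

lemma AbsContinuousOn.toInterval {f : ℝ → ℝ} {s : Set ℝ} (hf : AbsContinuousOn f s) {a b : ℝ}
    (hab : uIcc a b ⊆ s) : AbsolutelyContinuousOnInterval f a b := by
  rw [absolutelyContinuousOnInterval_iff]
  intro ε hε
  obtain ⟨δ, hδ, h⟩ := hf ε hε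
  refine ⟨δ, hδ, ?_⟩
  rintro ⟨n, I⟩ ⟨hI, hd⟩ hlen
  have key : ∀ i, |f (max (I i).1 (I i).2) - f (min (I i).1 (I i).2)|
      = dist (f (I i).1) (f (I i).2) := by
    intro i
    rw [Real.dist_eq]
    rcases le_total (I i).1 (I i).2 with h | h
    · rw [max_eq_right h, min_eq_left h, abs_sub_comm]
    · rw [max_eq_left h, min_eq_right h]
  have := h n (fun i => min (I i).1 (I i).2) (fun i => max (I i).1 (I i).2) ?_ ?_ ?_
  · simpa only [key] using this
  · intro i hi
    obtain ⟨h1, h2⟩ := hI i (Finset.mem_range.2 hi)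
    refine ⟨?_, ?_, min_le_max⟩
    · rcases min_choice (I i).1 (I i).2 with h | h <;> rw [h]
      exacts [hab h1, hab h2]
    · rcases max_choice (I i).1 (I i).2 with h | h <;> rw [h]
      exacts [hab h1, hab h2]
  · intro i hi j hj hij
    have := hd (Finset.mem_coe.2 (Finset.mem_range.2 hi)) (Finset.mem_coe.2 (Finset.mem_range.2 hj)) hij
    exact this.mono Ioo_subset_Ioc_self Ioo_subset_Ioc_self
  · simpa only [max_sub_min_eq_abs', ← Real.dist_eq] using hlen

lemma AbsolutelyContinuousOnInterval.toOn {f : ℝ → ℝ} {a b : ℝ}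
    (hf : AbsolutelyContinuousOnInterval f a b) {s : Set ℝ} (hs : s ⊆ uIcc a b) :
    AbsContinuousOn f s := by
  rw [absolutelyContinuousOnInterval_iff] at hf
  intro ε hε
  obtain ⟨δ, hδ, h⟩ := hf ε hε
  refine ⟨δ, hδ, ?_⟩
  intro n p q hpq hd hlen
  have := h (n, fun i => (p i, q i)) ⟨?_, ?_⟩ ?_
  · simpa only [Real.dist_eq, abs_sub_comm] using this
  · intro i hi
    obtain ⟨h1, h2, h3⟩ := hpq i (Finset.mem_range.1 hi)
    exact ⟨hs h1, hs h2⟩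
  · intro i hi j hj hij
    have hi' := Finset.mem_range.1 (Finset.mem_coe.1 hi)
    have hj' := Finset.mem_range.1 (Finset.mem_coe.1 hj)
    have hdd := hd i hi' j hj' hij
    change Disjoint (uIoc (p i) (q i)) (uIoc (p j) (q j))
    rw [uIoc_of_le (hpq i hi').2.2, uIoc_of_le (hpq j hj').2.2]
    rw [disjoint_left] at hdd ⊢
    rintro x ⟨h1, h2⟩ ⟨h3, h4⟩
    obtain ⟨z, hz1, hz2⟩ := exists_between (max_lt h1 h3)
    have := max_lt_iff.1 hz1
    exact hdd (a := z) ⟨this.1, hz2.trans_le h2⟩ ⟨this.2, hz2.trans_le h4⟩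
  · refine lt_of_eq_of_lt (Finset.sum_congr rfl fun i hi => ?_) hlen
    have := (hpq i (Finset.mem_range.1 hi)).2.2
    rw [dist_comm, Real.dist_eq, abs_of_nonneg (by linarith)]

lemma AbsContinuousOn.congr {f g : ℝ → ℝ} {s : Set ℝ} (hf : AbsContinuousOn f s)
    (h : ∀ x ∈ s, g x = f x) : AbsContinuousOn g s := by
  intro ε hε
  obtain ⟨δ, hδ, H⟩ := hf ε hε
  refine ⟨δ, hδ, ?_⟩
  intro n p q hpq hd hlen
  refine lt_of_eq_of_lt (Finset.sum_congr rfl fun i hi => ?_) (H n p q hpq hd hlen)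
  obtain ⟨h1, h2, h3⟩ := hpq i (Finset.mem_range.1 hi)
  rw [h _ h1, h _ h2]

/-- Fundamental theorem of calculus with a prescribed a.e. derivative. -/
lemma ac_ftc {f g : ℝ → ℝ} {a b : ℝ} (hab : a ≤ b) (hf : AbsolutelyContinuousOnInterval f a b)
    (hd : ∀ᵐ t ∂(volume.restrict (Ioo a b)), HasDerivAt f (g t) t) :
    IntervalIntegrable g volume a b ∧ ∫ t in a..b, g t = f b - f a := by
  have hd' : ∀ᵐ t ∂(volume.restrict (uIoc a b)), deriv f t = g t := by
    rw [uIoc_of_le hab, ← restrict_Ioo_eq_restrict_Ioc]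
    filter_upwards [hd] with t ht using ht.deriv
  refine ⟨hf.intervalIntegrable_deriv.congr_ae hd', ?_⟩
  rw [← hf.integral_deriv_eq_sub]
  apply intervalIntegral.integral_congr_ae_restrict
  filter_upwards [hd'] with t ht using ht.symm

/-- Gronwall type bound. -/
lemma ac_gronwall {f g : ℝ → ℝ} {a b C : ℝ} (hab : a ≤ b)
    (hf : AbsolutelyContinuousOnInterval f a b)
    (hd : ∀ᵐ t ∂(volume.restrict (Ioo a b)), HasDerivAt f (g t) t)
    (hg : ∀ᵐ t ∂(volume.restrict (Ioo a b)), - (C * f t) ≤ g t) :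
    f a ≤ Real.exp (C * (b - a)) * f b := by
  have he : AbsolutelyContinuousOnInterval (fun t => Real.exp (C * (t - a))) a b := by
    apply ContDiffOn.absolutelyContinuousOnInterval
    apply ContDiff.contDiffOn
    fun_prop
  have hm := he.fun_mul hf
  have hder : ∀ᵐ t ∂(volume.restrict (Ioo a b)), HasDerivAt
      (fun t => Real.exp (C * (t - a)) * f t)
      (Real.exp (C * (t - a)) * (C * f t + g t)) t := by
    filter_upwards [hd] with t ht
    have h1 : HasDerivAt (fun t => Real.exp (C * (t - a))) (Real.exp (C * (t - a)) * C) t := by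
      have := (((hasDerivAt_id t).sub_const a).const_mul C).exp
      simpa using this
    convert! h1.mul ht using 1
    ring
  have := (ac_ftc hab hm hder).2
  have h0 : 0 ≤ ∫ t in a..b, Real.exp (C * (t - a)) * (C * f t + g t) := by
    rw [intervalIntegral.integral_of_le hab, ← restrict_Ioo_eq_restrict_Ioc]
    apply integral_nonneg_of_ae
    filter_upwards [hg] with t ht
    have := Real.exp_pos (C * (t - a))
    exact mul_nonneg this.le (by linarith)
  rw [this] at h0
  simp at h0
  linarith

lemma prim_tendsto {g : ℝ → ℝ} {u s : ℝ} (hus : u < s) (hg : IntervalIntegrable g volume u s) :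
    Tendsto (fun t => ∫ w in u..t, g w) (𝓝[>] u) (𝓝 0) := by
  have hc := (hg.absolutelyContinuousOnInterval_intervalIntegral
    (c := u) left_mem_uIcc).continuousOn u left_mem_uIcc
  have h2 : Tendsto (fun t => ∫ w in u..t, g w) (𝓝[uIcc u s] u) (𝓝 (∫ w in u..u, g w)) := hc
  rw [intervalIntegral.integral_same] at h2
  apply h2.mono_left
  rw [uIcc_of_le hus.le]
  refine nhdsWithin_le_iff.2 ?_
  exact mem_of_superset (Ioc_mem_nhdsGT hus) Ioc_subset_Icc_self

lemma core {u s s' C c : ℝ} (hus : u < s) (hss' : s < s') (hC : 0 ≤ C)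
    (F a d : ℕ → ℝ → ℝ) (c' : ℕ → ℝ) (f A D : ℝ → ℝ)
    (hF0 : ∀ n, ∀ t ∈ Ioc u s, 0 ≤ F n t)
    (hFle : ∀ n, ∀ t ∈ Ioc u s, F n t ≤ f t)
    (hFlim : ∀ t ∈ Ioc u s, Tendsto (fun n => F n t) atTop (𝓝 (f t)))
    (hc : ∀ n, Tendsto (F n) (𝓝[>] u) (𝓝 (c' n)))
    (hclim : Tendsto c' atTop (𝓝 c))
    (hAC : ∀ n, AbsContinuousOn (F n) (Ioo u s'))
    (hder : ∀ n, ∀ᵐ t ∂(volume.restrict (Ioo u s)), HasDerivAt (F n) (-a n t + d n t) t)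
    (ha0 : ∀ n, ∀ t ∈ Ioo u s, 0 ≤ a n t)
    (hale : ∀ n, ∀ t ∈ Ioo u s, a n t ≤ C * F n t)
    (ham : ∀ n, AEMeasurable (a n) (volume.restrict (Ioo u s)))
    (halim : ∀ t ∈ Ioo u s, Tendsto (fun n => a n t) atTop (𝓝 (A t)))
    (hd0 : ∀ n t, 0 ≤ d n t)
    (hdmono : ∀ᵐ t ∂(volume.restrict (Ioo u s)), Monotone fun n => d n t)
    (hdlim : ∀ᵐ t ∂(volume.restrict (Ioo u s)), BddAbove (range fun n => d n t) →
      Tendsto (fun n => d n t) atTop (𝓝 (D t))) :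
    (Tendsto f (𝓝[>] u) (𝓝 c) ∧ AbsContinuousOn f (Ioo u s)) ∧
      ∀ᵐ t ∂(volume.restrict (Ioo u s)), HasDerivAt f (-A t + D t) t := by
  set μ := volume.restrict (Ioo u s) with hμ
  have hmem : ∀ᵐ t ∂μ, t ∈ Ioo u s := ae_restrict_mem measurableSet_Ioo
  have hfin : IsFiniteMeasure μ := by rw [hμ]; infer_instance
  set M := Real.exp (C * (s - u)) * f s with hM
  have hsm : s ∈ Ioc u s := ⟨hus, le_rfl⟩
  have hfs : 0 ≤ f s := (hF0 0 s hsm).trans (hFle 0 s hsm)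
  have hM0 : 0 ≤ M := mul_nonneg (Real.exp_pos _).le hfs
  have hACI : ∀ n t t', u < t → t ≤ s → u < t' → t' ≤ s →
      AbsolutelyContinuousOnInterval (F n) t t' := by
    intro n t t' h1 h2 h3 h4
    apply (hAC n).toInterval
    intro z hz
    rw [mem_uIcc] at hz
    constructor <;> rcases hz with hz | hz <;> linarith
  have hres : ∀ t t', u ≤ t → t' ≤ s → volume.restrict (Ioo t t') ≤ μ := fun t t' h1 h2 =>
    Measure.restrict_mono (Ioo_subset_Ioo h1 h2) le_rfl
  -- uniform bound
  have hFM : ∀ n, ∀ t ∈ Ioc u s, F n t ≤ M := by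
    intro n t ht
    have h1 := ac_gronwall (C := C) ht.2 (hACI n t s ht.1 ht.2 hus le_rfl)
      (ae_mono (hres t s ht.1.le le_rfl) (hder n)) (by
        filter_upwards [ae_mono (hres t s ht.1.le le_rfl) hmem] with w hw
        have := hale n w hw
        have := hd0 n w
        linarith)
    refine h1.trans ?_
    refine mul_le_mul ?_ (hFle n s hsm) (hF0 n s hsm) (Real.exp_pos _).le
    apply Real.exp_le_exp.2
    apply mul_le_mul_of_nonneg_left _ hC
    linarith [ht.1]
  have haM : ∀ n, ∀ t ∈ Ioo u s, a n t ≤ C * M := fun n t ht =>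
    (hale n t ht).trans (mul_le_mul_of_nonneg_left (hFM n t ⟨ht.1, ht.2.le⟩) hC)
  have hai : ∀ n, Integrable (a n) μ := by
    intro n
    refine Integrable.of_bound (ham n).aestronglyMeasurable (C * M) ?_
    filter_upwards [hmem] with t ht
    rw [Real.norm_eq_abs, abs_of_nonneg (ha0 n t ht)]
    exact haM n t ht
  have haii : ∀ n, IntervalIntegrable (a n) volume u s := fun n =>
    (intervalIntegrable_iff_integrableOn_Ioo_of_le hus.le).2 (hai n)
  have hasub : ∀ n t, u < t → t ≤ s → IntervalIntegrable (a n) volume t s := fun n t h1 h2 =>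
    (haii n).mono_set (by rw [uIcc_of_le h2, uIcc_of_le hus.le]; exact Icc_subset_Icc h1.le le_rfl)
  have ha_le : ∀ n t, u ≤ t → t ≤ s → ∫ w in t..s, a n w ≤ C * M * (s - u) := by
    intro n t h1 h2
    have hh : ∫ w in t..s, a n w ≤ ∫ w in t..s, C * M := by
      rw [intervalIntegral.integral_of_le h2, intervalIntegral.integral_of_le h2,
        ← restrict_Ioo_eq_restrict_Ioc]
      refine integral_mono_ae ((hai n).mono_measure (hres t s h1 le_rfl)) (integrable_const _) ?_
      filter_upwards [ae_mono (hres t s h1 le_rfl) hmem] with w hw using haM n w hw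
    rw [intervalIntegral.integral_const, smul_eq_mul] at hh
    refine hh.trans ?_
    rw [mul_comm]
    exact mul_le_mul_of_nonneg_left (by linarith) (by positivity)
  set K := f s + C * M * (s - u) with hK
  have hftc : ∀ n t t', u < t → t ≤ t' → t' ≤ s →
      IntervalIntegrable (fun w => -a n w + d n w) volume t t' ∧
        ∫ w in t..t', (-a n w + d n w) = F n t' - F n t := by
    intro n t t' h1 h2 h3
    exact ac_ftc h2 (hACI n t t' h1 (h2.trans h3) (h1.trans_le h2) h3)
      (ae_mono (hres t t' h1.le h3) (hder n))
  have hdi : ∀ n, IntegrableOn (d n) (Ioc u s) := by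
    intro n
    obtain ⟨τ, -, hτm, hτ⟩ := exists_seq_strictAnti_tendsto' hus
    have hIntg : ∀ i, IntervalIntegrable (d n) volume (τ i) s := by
      intro i
      have h1 := (hftc n (τ i) s (hτm i).1 (hτm i).2.le le_rfl).1
      have h2 := h1.add (hasub n (τ i) (hτm i).1 (hτm i).2.le)
      refine h2.congr ?_
      intro w _
      simp
    refine integrableOn_Ioc_of_intervalIntegral_norm_bounded_left (l := atTop) (a := τ) (I := K)
      (fun i => (intervalIntegrable_iff_integrableOn_Ioc_of_le (hτm i).2.le).1 (hIntg i)) hτ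
      (Eventually.of_forall fun i => ?_)
    have h3 := (hftc n (τ i) s (hτm i).1 (hτm i).2.le le_rfl).2
    have hA := hasub n (τ i) (hτm i).1 (hτm i).2.le
    have hAn : IntervalIntegrable (fun w => - a n w) volume (τ i) s := hA.neg
    rw [intervalIntegral.integral_add hAn (hIntg i),
      intervalIntegral.integral_neg] at h3
    have h4 := ha_le n (τ i) (hτm i).1.le (hτm i).2.le
    have h5 : ∫ x in Ioc (τ i) s, ‖d n x‖ = ∫ x in (τ i)..s, d n x := by
      rw [intervalIntegral.integral_of_le (hτm i).2.le]
      congr 1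
      ext x
      exact Real.norm_of_nonneg (hd0 n x)
    rw [h5]
    have := hF0 n (τ i) ⟨(hτm i).1, (hτm i).2.le⟩
    have := hFle n s hsm
    linarith
  have hdii : ∀ n, IntervalIntegrable (d n) volume u s := fun n =>
    (intervalIntegrable_iff_integrableOn_Ioc_of_le hus.le).2 (hdi n)
  have hdμ : ∀ n, Integrable (d n) μ := fun n => (hdi n).mono_set Ioo_subset_Ioc_self
  have hgii : ∀ n, IntervalIntegrable (fun w => -a n w + d n w) volume u s := fun n =>
    (haii n).neg.add (hdii n)
  have hrep : ∀ n, ∀ t ∈ Ioc u s, ∫ w in u..t, (-a n w + d n w) = F n t - c' n := by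
    intro n t ht
    have h1 : Tendsto (fun r => F n t - F n r) (𝓝[>] u) (𝓝 (F n t - c' n)) :=
      tendsto_const_nhds.sub (hc n)
    have h2 : Tendsto (fun r => (∫ w in u..t, (-a n w + d n w)) - ∫ w in u..r, (-a n w + d n w))
        (𝓝[>] u) (𝓝 ((∫ w in u..t, (-a n w + d n w)) - 0)) :=
      tendsto_const_nhds.sub (prim_tendsto hus (hgii n))
    rw [sub_zero] at h2
    refine tendsto_nhds_unique (h2.congr' ?_) h1
    filter_upwards [Ioc_mem_nhdsGT ht.1] with r hr
    rw [← (hftc n r t hr.1 hr.2 ht.2).2]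
    have e1 : IntervalIntegrable (fun w => -a n w + d n w) volume u r := (hgii n).mono_set (by
      rw [uIcc_of_le hr.1.le, uIcc_of_le hus.le]; exact Icc_subset_Icc le_rfl (hr.2.trans ht.2))
    have e2 := (hftc n r t hr.1 hr.2 ht.2).1
    rw [← intervalIntegral.integral_add_adjacent_intervals e1 e2]
    ring
  have hc0 : ∀ n, 0 ≤ c' n := fun n => ge_of_tendsto (hc n) (by
    filter_upwards [Ioc_mem_nhdsGT hus] with r hr using hF0 n r hr)
  have hdK : ∀ n, ∫ w, d n w ∂μ ≤ K := by
    intro n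
    have h3 := hrep n s hsm
    have hAn : IntervalIntegrable (fun w => - a n w) volume u s := (haii n).neg
    rw [intervalIntegral.integral_add hAn (hdii n), intervalIntegral.integral_neg] at h3
    have h4 := ha_le n u le_rfl hus.le
    have h5 : ∫ w, d n w ∂μ = ∫ w in u..s, d n w := by
      rw [intervalIntegral.integral_of_le hus.le, ← restrict_Ioo_eq_restrict_Ioc]
    rw [h5]
    have := hc0 n
    have := hFle n s hsm
    linarith
  -- monotone convergence
  have hsup : ∫⁻ w, ⨆ n, ENNReal.ofReal (d n w) ∂μ ≤ ENNReal.ofReal K := by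
    rw [lintegral_iSup' (fun n => (hdμ n).aemeasurable.ennreal_ofReal) (by
      filter_upwards [hdmono] with w hw
      intro i j hij
      exact ENNReal.ofReal_le_ofReal (hw hij))]
    refine iSup_le fun n => ?_
    rw [← ofReal_integral_eq_lintegral_ofReal (hdμ n) (Eventually.of_forall (hd0 n))]
    exact ENNReal.ofReal_le_ofReal (hdK n)
  have hsupm : AEMeasurable (fun w => ⨆ n, ENNReal.ofReal (d n w)) μ :=
    AEMeasurable.iSup fun n => (hdμ n).aemeasurable.ennreal_ofReal
  have hlt : ∀ᵐ w ∂μ, ⨆ n, ENNReal.ofReal (d n w) < ⊤ :=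
    ae_lt_top' hsupm (hsup.trans_lt ENNReal.ofReal_lt_top).ne
  have hdD : ∀ᵐ w ∂μ, Tendsto (fun n => d n w) atTop (𝓝 (D w)) := by
    filter_upwards [hlt, hdlim] with w hw1 hw2
    apply hw2
    refine ⟨(⨆ n, ENNReal.ofReal (d n w)).toReal, ?_⟩
    rintro _ ⟨n, rfl⟩
    rw [← ENNReal.ofReal_le_iff_le_toReal hw1.ne]
    exact le_iSup (fun n => ENNReal.ofReal (d n w)) n
  have hdle : ∀ᵐ w ∂μ, ∀ n, d n w ≤ D w := by
    filter_upwards [hdD, hdmono] with w h1 h2 n using h2.ge_of_tendsto h1 n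
  have hDm : AEStronglyMeasurable D μ :=
    aestronglyMeasurable_of_tendsto_ae atTop (fun n => (hdμ n).aestronglyMeasurable) hdD
  have hDi : Integrable D μ := by
    refine ⟨hDm, ?_⟩
    refine lt_of_le_of_lt (lintegral_mono_ae ?_) (hsup.trans_lt ENNReal.ofReal_lt_top)
    filter_upwards [hdD, hdle] with w h1 h2
    have hD0 : 0 ≤ D w := (hd0 0 w).trans (h2 0)
    rw [Real.enorm_eq_ofReal hD0]
    exact le_of_tendsto ((ENNReal.continuous_ofReal.tendsto _).comp h1)
      (Eventually.of_forall fun n => le_iSup (fun n => ENNReal.ofReal (d n w)) n)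
  have hAlim : ∀ᵐ w ∂μ, Tendsto (fun n => a n w) atTop (𝓝 (A w)) := by
    filter_upwards [hmem] with w hw using halim w hw
  have hAi : Integrable A μ := by
    refine Integrable.of_bound (aestronglyMeasurable_of_tendsto_ae atTop
      (fun n => (hai n).aestronglyMeasurable) hAlim) (C * M) ?_
    filter_upwards [hmem, hAlim] with w hw h1
    have h2 : 0 ≤ A w := ge_of_tendsto' h1 fun n => ha0 n w hw
    rw [Real.norm_of_nonneg h2]
    exact le_of_tendsto' h1 fun n => haM n w hw
  have hgi : Integrable (fun w => -A w + D w) μ := hAi.neg.add hDi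
  have hgI : IntervalIntegrable (fun w => -A w + D w) volume u s :=
    (intervalIntegrable_iff_integrableOn_Ioo_of_le hus.le).2 hgi
  have hfinal : ∀ t ∈ Ioc u s, f t = c + ∫ w in u..t, (-A w + D w) := by
    intro t ht
    have hle := hres u t le_rfl ht.2
    have h1 : Tendsto (fun n => ∫ w in u..t, (-a n w + d n w)) atTop
        (𝓝 (∫ w in u..t, (-A w + D w))) := by
      simp only [intervalIntegral.integral_of_le ht.1.le, ← restrict_Ioo_eq_restrict_Ioc]
      refine tendsto_integral_of_dominated_convergence (fun w => C * M + D w) ?_ ?_ ?_ ?_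
      · intro n
        exact (((hai n).neg.add (hdμ n)).mono_measure hle).aestronglyMeasurable
      · exact (integrable_const _).add (hDi.mono_measure hle)
      · intro n
        filter_upwards [ae_mono hle hmem, ae_mono hle hdle] with w hw h1
        have := ha0 n w hw
        have := haM n w hw
        have := hd0 n w
        have := h1 n
        rw [Real.norm_eq_abs, abs_le]
        constructor <;> linarith
      · filter_upwards [ae_mono hle hAlim, ae_mono hle hdD] with w h1 h2 using h1.neg.add h2
    have h2 : Tendsto (fun n => ∫ w in u..t, (-a n w + d n w)) atTop (𝓝 (f t - c)) := by
      simp only [hrep _ t ht]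
      exact (hFlim t ht).sub hclim
    rw [tendsto_nhds_unique h1 h2]
    ring
  refine ⟨⟨?_, ?_⟩, ?_⟩
  · have h1 : Tendsto (fun t => c + ∫ w in u..t, (-A w + D w)) (𝓝[>] u) (𝓝 (c + 0)) :=
      tendsto_const_nhds.add (prim_tendsto hus hgI)
    rw [add_zero] at h1
    refine h1.congr' ?_
    filter_upwards [Ioc_mem_nhdsGT hus] with t ht using (hfinal t ht).symm
  · have h1 := (hgI.absolutelyContinuousOnInterval_intervalIntegral (c := u) left_mem_uIcc).toOn
      (s := Ioo u s) (by rw [uIcc_of_le hus.le]; exact Ioo_subset_Icc_self)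
    have h2 : AbsContinuousOn (fun t => c + ∫ w in u..t, (-A w + D w)) (Ioo u s) := by
      intro ε hε
      obtain ⟨δ, hδ, H⟩ := h1 ε hε
      refine ⟨δ, hδ, fun n p q e1 e2 e3 => ?_⟩
      simpa only [add_sub_add_left_eq_sub] using H n p q e1 e2 e3
    exact h2.congr fun t ht => hfinal t ⟨ht.1, ht.2.le⟩
  · have h1 := ae_restrict_of_ae (s := Ioo u s) hgI.ae_hasDerivAt_integral
    filter_upwards [h1, hmem] with t h2 ht
    have h3 := (h2 (by rw [uIcc_of_le hus.le]; exact ⟨ht.1.le, ht.2.le⟩) u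
      left_mem_uIcc).const_add c
    refine h3.congr_of_eventuallyEq ?_
    filter_upwards [Ioo_mem_nhds ht.1 ht.2] with r hr using hfinal r ⟨hr.1, hr.2.le⟩

lemma aemeas_lintegral {X : Type*} [MeasurableSpace X] (κ : ℝ → Measure X)
    (hκ : ∀ B, MeasurableSet B → Measurable fun w => κ w B) (h : ℝ → X → ℝ≥0∞)
    (hh : Measurable (Function.uncurry h)) (S : Set ℝ) (hS : MeasurableSet S)
    (hfin : ∀ w ∈ S, κ w univ ≠ ⊤) :
    AEMeasurable (fun w => ∫⁻ y, h w y ∂(κ w)) (volume.restrict S) := by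
  have hm1 : Measurable fun w => (1 + κ w univ)⁻¹ :=
    (measurable_const.add (hκ univ MeasurableSet.univ)).inv
  let K : ProbabilityTheory.Kernel ℝ X :=
    ⟨fun w => (1 + κ w univ)⁻¹ • κ w, by
      apply Measure.measurable_of_measurable_coe
      intro B hB
      simp only [Measure.smul_apply, smul_eq_mul]
      exact hm1.mul (hκ B hB)⟩
  have hKf : ProbabilityTheory.IsFiniteKernel K := by
    refine ⟨⟨1, ENNReal.one_lt_top, fun w => ?_⟩⟩
    change ((1 + κ w univ)⁻¹ • κ w) univ ≤ 1
    rw [Measure.smul_apply, smul_eq_mul, mul_comm, ← div_eq_mul_inv]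
    exact ENNReal.div_le_of_le_mul (by rw [one_mul]; exact le_add_self)
  have hm2 : Measurable fun w => ∫⁻ y, h w y ∂(K w) := hh.lintegral_kernel_prod_right
  have hm3 : Measurable fun w => (1 + κ w univ) * ∫⁻ y, h w y ∂(K w) :=
    (measurable_const.add (hκ univ MeasurableSet.univ)).mul hm2
  refine hm3.aemeasurable.congr ?_
  filter_upwards [ae_restrict_mem hS] with w hw
  change (1 + κ w univ) * ∫⁻ y, h w y ∂((1 + κ w univ)⁻¹ • κ w) = _
  rw [lintegral_smul_measure, smul_eq_mul, ← mul_assoc, ENNReal.mul_inv_cancel, one_mul]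
  · simp
  · exact ENNReal.add_ne_top.2 ⟨ENNReal.one_ne_top, hfin w hw⟩

lemma QBddOn_mono {X : Type*} [MeasurableSpace X] {T₀ : ℝ} {T₁ : EReal} {Q : ConsQFun X T₀ T₁}
    {s s' : EReal} {B B' : Set X} (h : Q.QBddOn s B) (hs : s' ≤ s) (hB : B' ⊆ B) :
    Q.QBddOn s' B' := by
  obtain ⟨C, hC, H⟩ := h
  exact ⟨C, hC, fun x hx t h1 h2 => H x (hB hx) t h1 (h2.trans_le hs)⟩

lemma meas_qp {X : Type*} [MeasurableSpace X] {T₀ : ℝ} {T₁ : EReal} (Q : ConsQFun X T₀ T₁)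
    (t : ℝ) {B : Set X} (hB : MeasurableSet B) : Measurable fun y => Q.qp y t B :=
  (Q.meas B hB).comp (measurable_id.prodMk measurable_const)

lemma qp_ne_top {X : Type*} [MeasurableSpace X] {T₀ : ℝ} {T₁ : EReal} (Q : ConsQFun X T₀ T₁)
    (y : X) (t : ℝ) (B : Set X) : Q.qp y t B ≠ ⊤ :=
  ((measure_mono (subset_univ B)).trans_lt (Q.fin y t).lt_top).ne

lemma qrate_integrableOn {X : Type*} [MeasurableSpace X] {T₀ : ℝ} {T₁ : EReal}
    (Q : ConsQFun X T₀ T₁) {B : Set X} (hB : MeasurableSet B) {s : EReal} (hQ : Q.QBddOn s B)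
    {t : ℝ} (h1 : T₀ ≤ t) (h2 : (t : EReal) < s) (ν : Measure X) (hν : ν univ ≠ ⊤) :
    IntegrableOn (fun y => Q.qrate y t) B ν := by
  obtain ⟨C, hC, H⟩ := hQ
  refine Measure.integrableOn_of_bounded (M := C.toReal)
    ((measure_mono (subset_univ B)).trans_lt hν.lt_top).ne
    (meas_qp Q t MeasurableSet.univ).ennreal_toReal.aestronglyMeasurable ?_
  filter_upwards [ae_restrict_mem hB] with y hy
  change ‖(Q.qp y t univ).toReal‖ ≤ _
  rw [Real.norm_of_nonneg ENNReal.toReal_nonneg]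
  exact ENNReal.toReal_mono hC (H y hy t h1 h2)

/-- The gain term along an exhaustion, including the degenerate non-integrable case. -/
lemma gain_tendsto {X : Type*} [MeasurableSpace X] {T₀ : ℝ} {T₁ : EReal}
    (Q : ConsQFun X T₀ T₁) (B : ℕ → Set X) (hBm : ∀ n, MeasurableSet (B n)) (hmono : Monotone B)
    (t : ℝ) (ν : Measure X)
    (hb : BddAbove (range fun n => ∫ y, (Q.qp y t (B n)).toReal ∂ν)) :
    Tendsto (fun n => ∫ y, (Q.qp y t (B n)).toReal ∂ν) atTop
      (𝓝 (∫ y, (Q.qp y t (⋃ n, B n)).toReal ∂ν)) := by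
  have hUm : MeasurableSet (⋃ n, B n) := MeasurableSet.iUnion hBm
  have e : ∀ E, MeasurableSet E →
      ∫ y, (Q.qp y t E).toReal ∂ν = (∫⁻ y, Q.qp y t E ∂ν).toReal := fun E hE =>
    integral_toReal (meas_qp Q t hE).aemeasurable
      (Eventually.of_forall fun y => (qp_ne_top Q y t E).lt_top)
  have hL : Tendsto (fun n => ∫⁻ y, Q.qp y t (B n) ∂ν) atTop
      (𝓝 (∫⁻ y, Q.qp y t (⋃ n, B n) ∂ν)) := by
    refine lintegral_tendsto_of_tendsto_of_monotone (fun n => (meas_qp Q t (hBm n)).aemeasurable)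
      (Eventually.of_forall fun y => fun i j hij => measure_mono (hmono hij))
      (Eventually.of_forall fun y => tendsto_measure_iUnion_atTop hmono)
  simp only [e _ hUm, fun n => e _ (hBm n)] at hb ⊢
  by_cases hN : ∃ N, ∫⁻ y, Q.qp y t (B N) ∂ν = ⊤
  · obtain ⟨N, hN⟩ := hN
    have h1 : ∀ n, N ≤ n → ∫⁻ y, Q.qp y t (B n) ∂ν = ⊤ := fun n hn =>
      top_le_iff.1 (hN ▸ lintegral_mono fun y => measure_mono (hmono hn))
    have h2 : ∫⁻ y, Q.qp y t (⋃ n, B n) ∂ν = ⊤ :=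
      top_le_iff.1 (hN ▸ lintegral_mono fun y => measure_mono (subset_iUnion B N))
    rw [h2]
    refine tendsto_const_nhds.congr' ?_
    filter_upwards [eventually_ge_atTop N] with n hn
    rw [h1 n hn]
  · push Not at hN
    obtain ⟨K, hK⟩ := hb
    have h1 : ∀ n, ∫⁻ y, Q.qp y t (B n) ∂ν ≤ ENNReal.ofReal K := by
      intro n
      rw [← ENNReal.ofReal_toReal (hN n)]
      exact ENNReal.ofReal_le_ofReal (hK ⟨n, rfl⟩)
    have h2 := le_of_tendsto' hL h1
    exact (ENNReal.tendsto_toReal (h2.trans_lt ENNReal.ofReal_lt_top).ne).comp hL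
/-- under Assumption LB, a function `P ∈ 𝒫̂` satisfies the boundary
condition, absolute continuity on `(u,s)` and Kolmogorov's forward equation a.e. on
`(u,s)` for all `(q,s)`-bounded Borel sets `B` (for all `s ∈ (u,T₁)`) if and only if it
satisfies: (a) for all `u ∈ [T₀,T₁)`, `x ∈ X` and `q`-bounded Borel `B`, the boundary
condition at `t → u+` and absolute continuity on `(u,s)` for each `s ∈ (u,T₁)`; and
(b) for all such `u`, `x`, `B`, Kolmogorov's forward equation for almost every
`t ∈ (u,T₁)`. -/
theorem forward_equation_qs_bounded_iff_q_bounded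
    {X : Type*} [MeasurableSpace X] [StandardBorelSpace X]
    {T₀ : ℝ} {T₁ : EReal} (hT : (T₀ : EReal) < T₁)
    (Q : ConsQFun X T₀ T₁) (hLB : Q.AssumptionLB)
    (P : ℝ → X → ℝ → Measure X)
    (hfin : ∀ (u t : ℝ) (x : X), T₀ ≤ u → u < t → (t : EReal) < T₁ →
      P u x t Set.univ ≠ ⊤)
    (hmeas : ∀ (u : ℝ) (x : X) (B : Set X), T₀ ≤ u → (u : EReal) < T₁ → MeasurableSet B →
      Measurable fun t => P u x t B) :
    ((∀ (u s : ℝ) (x : X) (B : Set X), T₀ ≤ u → u < s → (s : EReal) < T₁ →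
        MeasurableSet B → Q.QBddOn (s : EReal) B →
        (Filter.Tendsto (fun t => (P u x t B).toReal) (𝓝[>] u)
          (𝓝 (B.indicator (fun _ => (1 : ℝ)) x)) ∧
        AbsContinuousOn (fun t => (P u x t B).toReal) (Set.Ioo u s)) ∧
        ∀ᵐ t ∂(volume.restrict (Set.Ioo u s)),
          HasDerivAt (fun r => (P u x r B).toReal)
            (-(∫ y in B, Q.qrate y t ∂(P u x t)) +
              ∫ y, (Q.qp y t B).toReal ∂(P u x t)) t) ↔
      ((∀ (u : ℝ) (x : X) (B : Set X), T₀ ≤ u → (u : EReal) < T₁ →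
          MeasurableSet B → Q.QBddOn T₁ B →
          Filter.Tendsto (fun t => (P u x t B).toReal) (𝓝[>] u)
            (𝓝 (B.indicator (fun _ => (1 : ℝ)) x)) ∧
          ∀ s : ℝ, u < s → (s : EReal) < T₁ →
            AbsContinuousOn (fun t => (P u x t B).toReal) (Set.Ioo u s)) ∧
        (∀ (u : ℝ) (x : X) (B : Set X), T₀ ≤ u → (u : EReal) < T₁ →
          MeasurableSet B → Q.QBddOn T₁ B →
          ∀ᵐ t ∂(volume.restrict {t : ℝ | u < t ∧ (t : EReal) < T₁}),
            HasDerivAt (fun r => (P u x r B).toReal)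
              (-(∫ y in B, Q.qrate y t ∂(P u x t)) +
                ∫ y, (Q.qp y t B).toReal ∂(P u x t)) t))) := by
  constructor
  · intro H
    refine ⟨?_, ?_⟩
    · intro u x B hu huT hB hQ
      obtain ⟨s, hs1, hs2⟩ := EReal.lt_iff_exists_real_btwn.1 huT
      refine ⟨(H u s x B hu (by exact_mod_cast hs1) hs2 hB
        (QBddOn_mono hQ hs2.le subset_rfl)).1.1, ?_⟩
      intro s hs1 hs2
      exact (H u s x B hu hs1 hs2 hB (QBddOn_mono hQ hs2.le subset_rfl)).1.2
    · intro u x B hu huT hB hQ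
      have hsub : {t : ℝ | u < t ∧ (t : EReal) < T₁} ⊆
          ⋃ r ∈ {r : ℚ | u < (r : ℝ) ∧ ((r : ℝ) : EReal) < T₁}, Ioo u (r : ℝ) := by
        rintro t ⟨h1, h2⟩
        obtain ⟨r, hr1, hr2⟩ := EReal.exists_rat_btwn_of_lt h2
        have hr1' : t < (r : ℝ) := by exact_mod_cast hr1
        exact mem_biUnion (x := r) ⟨h1.trans hr1', hr2⟩ ⟨h1, hr1'⟩
      refine ae_restrict_of_ae_restrict_of_subset hsub ?_
      rw [ae_restrict_biUnion_iff _ (to_countable _)]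
      intro r hr
      exact (H u r x B hu hr.1 hr.2 hB (QBddOn_mono hQ hr.2.le subset_rfl)).2
  · rintro ⟨Ha, Hb⟩ u s x B hu hus hsT hB hQ
    obtain ⟨E, hEm, hEmono, hEx, hEq⟩ := exists_exhaustion Q hLB
    obtain ⟨s', hs1', hs'T⟩ := EReal.lt_iff_exists_real_btwn.1 hsT
    have hss' : s < s' := by exact_mod_cast hs1'
    have hltT : ∀ t : ℝ, t ≤ s → (t : EReal) < T₁ := fun t ht =>
      lt_of_le_of_lt (by exact_mod_cast ht) hsT
    have huT : (u : EReal) < T₁ := hltT u hus.le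
    have hPfin : ∀ t ∈ Ioc u s, P u x t univ ≠ ⊤ := fun t ht =>
      hfin u t x hu ht.1 (hltT t ht.2)
    have hPfin' : ∀ t ∈ Ioc u s, ∀ G, P u x t G ≠ ⊤ := fun t ht G =>
      ((measure_mono (subset_univ G)).trans_lt (hPfin t ht).lt_top).ne
    have hIoo : ∀ t ∈ Ioo u s, t ∈ Ioc u s := fun t ht => ⟨ht.1, ht.2.le⟩
    obtain ⟨C, hC, hCb⟩ := id hQ
    set Bn : ℕ → Set X := fun n => B ∩ E n with hBn
    have hBnm : ∀ n, MeasurableSet (Bn n) := fun n => hB.inter (hEm n)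
    have hBmono : Monotone Bn := fun i j hij => inter_subset_inter_right _ (hEmono hij)
    have hBU : ⋃ n, Bn n = B := by
      rw [hBn, ← inter_iUnion]
      have : ⋃ n, E n = univ := eq_univ_of_forall fun y => mem_iUnion.2 (hEx y)
      rw [this, inter_univ]
    have hBq : ∀ n, Q.QBddOn T₁ (Bn n) := fun n =>
      QBddOn_mono (hEq n) le_rfl inter_subset_right
    have hder : ∀ G, MeasurableSet G → Q.QBddOn T₁ G →
        ∀ᵐ t ∂(volume.restrict (Ioo u s)), HasDerivAt (fun r => (P u x r G).toReal)
          (-(∫ y in G, Q.qrate y t ∂(P u x t)) + ∫ y, (Q.qp y t G).toReal ∂(P u x t)) t := by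
      intro G hG hGq
      have hsub : Ioo u s ⊆ {t : ℝ | u < t ∧ (t : EReal) < T₁} := fun t ht => ⟨ht.1, hltT t ht.2.le⟩
      exact ae_restrict_of_ae_restrict_of_subset hsub (Hb u x G hu huT hG hGq)
    have hae : ∀ t ∈ Ioc u s, ∀ n, ∫ y in Bn n, Q.qrate y t ∂(P u x t)
        = (∫⁻ y in Bn n, Q.qp y t univ ∂(P u x t)).toReal := by
      intro t ht n
      exact integral_toReal (meas_qp Q t MeasurableSet.univ).aemeasurable
        (Eventually.of_forall fun y => (Q.fin y t).lt_top)
    refine core (s' := s') (C := C.toReal) hus hss' ENNReal.toReal_nonneg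
      (fun n t => (P u x t (Bn n)).toReal)
      (fun n t => ∫ y in Bn n, Q.qrate y t ∂(P u x t))
      (fun n t => ∫ y, (Q.qp y t (Bn n)).toReal ∂(P u x t))
      (fun n => (Bn n).indicator (fun _ => (1 : ℝ)) x)
      (fun t => (P u x t B).toReal)
      (fun t => ∫ y in B, Q.qrate y t ∂(P u x t))
      (fun t => ∫ y, (Q.qp y t B).toReal ∂(P u x t))
      ?_ ?_ ?_ ?_ ?_ ?_ ?_ ?_ ?_ ?_ ?_ ?_ ?_ ?_
    · exact fun n t ht => ENNReal.toReal_nonneg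
    · exact fun n t ht => ENNReal.toReal_mono (hPfin' t ht B) (measure_mono inter_subset_left)
    · intro t ht
      have h1 : Tendsto (fun n => P u x t (Bn n)) atTop (𝓝 (P u x t (⋃ n, Bn n))) :=
        tendsto_measure_iUnion_atTop hBmono
      rw [hBU] at h1
      exact (ENNReal.tendsto_toReal (hPfin' t ht B)).comp h1
    · exact fun n => (Ha u x (Bn n) hu huT (hBnm n) (hBq n)).1
    · obtain ⟨N, hN⟩ := hEx x
      refine tendsto_const_nhds.congr' ?_
      filter_upwards [eventually_ge_atTop N] with n hn
      have hxn : x ∈ E n := hEmono hn hN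
      by_cases hxB : x ∈ B
      · rw [indicator_of_mem hxB, indicator_of_mem (show x ∈ Bn n from ⟨hxB, hxn⟩)]
      · rw [indicator_of_notMem hxB, indicator_of_notMem fun h : x ∈ Bn n => hxB h.1]
    · exact fun n => (Ha u x (Bn n) hu huT (hBnm n) (hBq n)).2 s' (hus.trans hss') hs'T
    · exact fun n => hder (Bn n) (hBnm n) (hBq n)
    · exact fun n t ht => integral_nonneg fun y => ENNReal.toReal_nonneg
    · intro n t ht
      rw [hae t (hIoo t ht), ← ENNReal.toReal_mul]
      refine ENNReal.toReal_mono (ENNReal.mul_ne_top hC (hPfin' t (hIoo t ht) _)) ?_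
      rw [← setLIntegral_const]
      refine setLIntegral_mono' (hBnm n) fun y hy => ?_
      exact hCb y hy.1 t (hu.trans ht.1.le) (by exact_mod_cast ht.2)
    · intro n
      have h1 := aemeas_lintegral (P u x) (fun G hG => hmeas u x G hu huT hG)
        (fun w y => (Bn n).indicator (fun y => Q.qp y w univ) y)
        (by
          have h2 : Measurable fun p : ℝ × X => Q.qp p.2 p.1 univ :=
            (Q.meas univ MeasurableSet.univ).comp measurable_swap
          exact h2.indicator (measurable_snd (hBnm n)))
        (Ioo u s) measurableSet_Ioo (fun w hw => hPfin w (hIoo w hw))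
      refine h1.ennreal_toReal.congr ?_
      filter_upwards [ae_restrict_mem measurableSet_Ioo] with t ht
      rw [hae t (hIoo t ht), lintegral_indicator (hBnm n)]
    · intro t ht
      have h1 := tendsto_setIntegral_of_monotone (μ := P u x t) (f := fun y => Q.qrate y t)
        hBnm hBmono (by
          rw [hBU]
          exact qrate_integrableOn Q hB hQ (hu.trans ht.1.le) (by exact_mod_cast ht.2) _
            (hPfin t (hIoo t ht)))
      rwa [hBU] at h1
    · exact fun n t => integral_nonneg fun y => ENNReal.toReal_nonneg
    · have h1 := ae_all_iff.2 fun n => hder (Bn n) (hBnm n) (hBq n)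
      have h2 := ae_all_iff.2 fun n => hder (Bn (n+1) \ Bn n) ((hBnm _).diff (hBnm n))
        (QBddOn_mono (hBq (n+1)) le_rfl diff_subset)
      filter_upwards [h1, h2, ae_restrict_mem measurableSet_Ioo] with t e1 e2 ht
      refine monotone_nat_of_le_succ fun n => ?_
      have hd : HasDerivAt (fun r => (P u x r (Bn (n+1))).toReal) _ t :=
        ((e1 n).add (e2 n)).congr_of_eventuallyEq (by
          filter_upwards [Ioo_mem_nhds ht.1 ht.2] with r hr
          have hr' := hIoo r hr
          have := measure_diff_add_inter (μ := P u x r) (Bn (n+1)) (hBnm n)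
          rw [inter_eq_self_of_subset_right (hBmono n.le_succ)] at this
          rw [← this, ENNReal.toReal_add (hPfin' r hr' _) (hPfin' r hr' _), add_comm]
          rfl)
      have hu1 := hd.unique (e1 (n+1))
      have hIntg : IntegrableOn (fun y => Q.qrate y t) (Bn (n+1)) (P u x t) :=
        qrate_integrableOn Q (hBnm _) (hBq _) (hu.trans ht.1.le) (hltT t ht.2.le) _
            (hPfin t (hIoo t ht))
      have hu2 := setIntegral_union (μ := P u x t) (f := fun y => Q.qrate y t)
        (disjoint_sdiff_right (s := Bn n) (t := Bn (n+1)))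
        ((hBnm (n+1)).diff (hBnm n)) (hIntg.mono_set (hBmono n.le_succ))
        (hIntg.mono_set diff_subset)
      rw [union_diff_cancel (hBmono n.le_succ)] at hu2
      have hu3 : 0 ≤ ∫ y, (Q.qp y t (Bn (n+1) \ Bn n)).toReal ∂(P u x t) :=
        integral_nonneg fun y => ENNReal.toReal_nonneg
      linarith
    · refine Eventually.of_forall fun t hb => ?_
      have := gain_tendsto Q Bn hBnm hBmono t (P u x t) hb
      rwa [hBU] at this
end
end
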